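/- Perfect secrecy of the Vernam cipher, Shannon form (Theorem 1): let μ be any probability mass function on messages in Fin n → ZMod 2, let the key K be uniform on Fin n → ZMod 2 and independent of the message M, and set C = M + K (bitwise addition in ZMod 2). Then the plaintext and the ciphertext are independent: for every message value m and every ciphertext value c, the joint probability P(M = m and C = c) equals μ(m) · (1/2)^n = P(M = m) · P(C = c). Equivalently, the a posteriori distribution of the plaintext given any observed ciphertext equals its a priori distribution μ. -/

import Mathlib

/-- Perfect secrecy of the Vernam cipher, Shannon form: for any plaintext
distribution `μ` on `Fin n → ZMod 2`, with the key uniform and independent of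
the message, the joint distribution of `(M, C)` with `C = M + K` satisfies
`P(M = m ∧ C = c) = μ m * (1/2)^n = P(M = m) * P(C = c)`, i.e. the plaintext and
ciphertext are independent. -/
theorem vernam_shannon_perfect_secrecy {n : ℕ} (μ : PMF (Fin n → ZMod 2))
    (m c : Fin n → ZMod 2) :
    (μ.bind fun m' => (PMF.uniformOfFintype (Fin n → ZMod 2)).map fun k => (m', m' + k))
        (m, c) = μ m * (1 / 2 : ENNReal) ^ n := by
  rw [PMF.bind_apply, tsum_eq_single m]
  · congr 1
    rw [PMF.map_apply, tsum_eq_single (c - m)]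
    · simp [ENNReal.inv_pow]
    · intro k hk
      rw [if_neg]
      intro h
      apply hk
      have h2 : c = m + k := (Prod.mk.inj h).2
      rw [h2]
      abel
  · intro m' hm'
    rw [PMF.map_apply]
    have h0 : ∀ k : Fin n → ZMod 2, ¬ ((m, c) = (m', m' + k)) :=
      fun k h => hm' (Prod.mk.inj h).1.symm
    simp only [h0, if_false, tsum_zero, mul_zero]
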